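/- arXiv:2310.11061 — 4 statements merged into one kernel-verified Lean document; each statement's English description precedes it below -/
import Mathlib

section
/- Let Ġ = (G, σ) be an unbalanced signed graph of order n and let k be an integer with 3 ≤ k ≤ n/10 − 1. If Ġ contains no negative cycle of length 2k+1 (i.e., Ġ is C_{2k+1}^--free), then e(Ġ) ≤ n(n−1)/2 − 2(n−3). -/
open scoped Classical

/-- A signed graph: a finite simple graph together with a symmetric sign function
taking value `1` or `-1` on every edge. -/
structure SignedGraph (V : Type*) where
  G : SimpleGraph V
  sign : V → V → ℤ
  sign_symm : ∀ u v, sign u v = sign v u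
  sign_pm : ∀ u v, G.Adj u v → sign u v = 1 ∨ sign u v = -1

namespace SignedGraph

variable {V : Type*} {W : Type*}

/-- The sign function on unordered pairs. -/
def edgeSign (SG : SignedGraph V) : Sym2 V → ℤ :=
  Sym2.lift ⟨SG.sign, SG.sign_symm⟩

/-- The sign of a walk: the product of the signs of its edges. -/
def walkSign (SG : SignedGraph V) {u v : V} (w : SG.G.Walk u v) : ℤ :=
  (w.edges.map SG.edgeSign).prod

/-- `Ġ` contains a negative cycle of length `l`. -/
def HasNegCycleLength (SG : SignedGraph V) (l : ℕ) : Prop :=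
  ∃ (v : V) (w : SG.G.Walk v v), w.IsCycle ∧ w.length = l ∧ SG.walkSign w = -1

/-- A signed graph is balanced if it is switching equivalent to the all-positive
signature on the same underlying graph. -/
def Balanced (SG : SignedGraph V) : Prop :=
  ∃ s : V → ℤ, (∀ x, s x = 1 ∨ s x = -1) ∧
    ∀ u v, SG.G.Adj u v → s u * SG.sign u v * s v = 1

/-- A signed graph is unbalanced if it is not balanced. -/
def Unbalanced (SG : SignedGraph V) : Prop := ¬ SG.Balanced

/-- The number of edges `e(Ġ)` of a signed graph. -/
noncomputable def edgeCount (SG : SignedGraph V) : ℕ := SG.G.edgeSet.ncard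

/-- Switching equivalence of signed graphs (up to isomorphism of the underlying
graphs): there is an isomorphism of the underlying graphs under which the two
signatures agree after a switching. -/
def SwitchEquiv (SG : SignedGraph V) (SH : SignedGraph W) : Prop :=
  ∃ (φ : SG.G ≃g SH.G) (s : V → ℤ), (∀ x, s x = 1 ∨ s x = -1) ∧
    ∀ u v, SG.G.Adj u v → SH.sign (φ u) (φ v) = s u * SG.sign u v * s v

end SignedGraph

namespace SignedGraph

variable {V : Type*} {SG : SignedGraph V}

/-- A path of length `r` and sign `ε` from `x` to `y` with all vertices in `S`. -/
def HasPath (SG : SignedGraph V) (S : Set V) (r : ℕ) (x y : V) (ε : ℤ) : Prop :=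
  ∃ p : SG.G.Walk x y, p.IsPath ∧ p.length = r ∧ SG.walkSign p = ε ∧ ∀ z ∈ p.support, z ∈ S

/-- Switching by `s` makes every edge inside `P` positive. -/
def BalancedBy (SG : SignedGraph V) (s : V → ℤ) (P : Set V) : Prop :=
  (∀ x, s x = 1 ∨ s x = -1) ∧
    ∀ u ∈ P, ∀ v ∈ P, SG.G.Adj u v → s u * SG.sign u v * s v = 1

/-- Any two vertices of `C` have a common neighbour in `C` outside any given set of at most
`m` vertices. -/
def Linked (SG : SignedGraph V) (C : Set V) (m : ℕ) : Prop :=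
  ∀ x ∈ C, ∀ y ∈ C, ∀ F : Finset V, F.card ≤ m → ∃ z ∈ C, z ∉ F ∧ SG.G.Adj x z ∧ SG.G.Adj y z

/-- The vertices with at least two neighbours in `C`. -/
def attached (SG : SignedGraph V) (C : Set V) : Set V :=
  {p | ∃ c ∈ C, ∃ c' ∈ C, c ≠ c' ∧ SG.G.Adj p c ∧ SG.G.Adj p c'}

theorem sign_mul_self {u v : V} (h : SG.G.Adj u v) : SG.sign u v * SG.sign u v = 1 := by
  rcases SG.sign_pm u v h with h | h <;> simp [h]

theorem walkSign_cons {u v w : V} (h : SG.G.Adj u v) (p : SG.G.Walk v w) :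
    SG.walkSign (.cons h p) = SG.sign u v * SG.walkSign p := by
  simp [walkSign, edgeSign]

theorem walkSign_reverse {u v : V} (p : SG.G.Walk u v) :
    SG.walkSign p.reverse = SG.walkSign p := by
  simp [walkSign, List.prod_reverse]

theorem walkSign_pm {u v : V} (p : SG.G.Walk u v) : SG.walkSign p = 1 ∨ SG.walkSign p = -1 := by
  induction p with
  | nil => simp [walkSign]
  | cons h p ih =>
    rw [walkSign_cons]
    rcases SG.sign_pm _ _ h with h | h <;> rcases ih with ih | ih <;> simp [h, ih]

namespace HasPath

variable {S T P : Set V} {r : ℕ} {x y v : V} {ε : ℤ}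

theorem refl (x : V) : SG.HasPath {x} 0 x x 1 :=
  ⟨.nil, by simp, rfl, by simp [walkSign], by simp⟩

theorem mono (h : SG.HasPath S r x y ε) (hST : S ⊆ T) : SG.HasPath T r x y ε := by
  obtain ⟨p, hp, hr, hε, hS⟩ := h
  exact ⟨p, hp, hr, hε, fun z hz => hST (hS z hz)⟩

theorem symm (h : SG.HasPath S r x y ε) : SG.HasPath S r y x ε := by
  obtain ⟨p, hp, hr, hε, hS⟩ := h
  exact ⟨p.reverse, hp.reverse, by simpa using hr, by rw [walkSign_reverse, hε],
    fun z hz => hS z (by simpa using hz)⟩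

theorem cons (h : SG.HasPath S r x y ε) (hv : v ∉ S) (ha : SG.G.Adj v x) :
    SG.HasPath (insert v S) (r + 1) v y (SG.sign v x * ε) := by
  obtain ⟨p, hp, hr, hε, hS⟩ := h
  refine ⟨.cons ha p, ?_, by simp [hr], by rw [walkSign_cons, hε], ?_⟩
  · rw [SimpleGraph.Walk.cons_isPath_iff]
    exact ⟨hp, fun h => hv (hS v h)⟩
  · intro z hz
    rw [SimpleGraph.Walk.support_cons, List.mem_cons] at hz
    exact hz.imp id (hS z)

theorem sign_pm (h : SG.HasPath S r x y ε) : ε = 1 ∨ ε = -1 := by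
  obtain ⟨p, -, -, rfl, -⟩ := h
  exact walkSign_pm p

/-- Closing a path by a new vertex adjacent to both ends gives a positive cycle. -/
theorem closed_sign (h : SG.HasPath S r x y ε) (hxy : x ≠ y) (hv : v ∉ S) (hx : SG.G.Adj v x)
    (hy : SG.G.Adj v y) (hfree : ¬ SG.HasNegCycleLength (r + 2)) :
    SG.sign v x * ε * SG.sign v y = 1 := by
  have hpm := h.sign_pm
  obtain ⟨p, hp, hr, hε, hS⟩ := h
  have hvp : v ∉ p.support := fun h => hv (hS v h)
  by_contra hne
  refine hfree ⟨y, .cons hy.symm (.cons hx p), ?_, by simp [hr], ?_⟩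
  · rw [SimpleGraph.Walk.cons_isCycle_iff, SimpleGraph.Walk.cons_isPath_iff,
      SimpleGraph.Walk.edges_cons, List.mem_cons, not_or]
    exact ⟨⟨hp, hvp⟩, by simp [hy.ne', hxy.symm],
      fun h => hvp (p.snd_mem_support_of_mem_edges h)⟩
  · rw [walkSign_cons, walkSign_cons, hε, SG.sign_symm y v]
    rcases SG.sign_pm _ _ hx with h1 | h1 <;> rcases SG.sign_pm _ _ hy with h2 | h2 <;>
      rcases hpm with h3 | h3 <;> simp [h1, h2, h3] at hne ⊢

theorem sign_eq {s : V → ℤ} (h : SG.HasPath P r x y ε) (hs : SG.BalancedBy s P) :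
    ε = s x * s y := by
  obtain ⟨p, -, -, rfl, hP⟩ := h
  clear r
  induction p with
  | nil =>
    rename_i u
    rcases hs.1 u with h | h <;> simp [walkSign, h]
  | @cons u v w h p ih =>
    rw [walkSign_cons, ih fun z hz => hP z (by simp [hz])]
    have := hs.2 u (hP u (by simp)) v (hP v (by simp)) h
    rcases SG.sign_pm _ _ h with h1 | h1 <;> rcases hs.1 u with h2 | h2 <;>
      rcases hs.1 v with h3 | h3 <;> simp [h1, h2, h3] at this ⊢

end HasPath

section Core

variable {C : Set V} {m : ℕ}

/-- A linked set contains paths of every admissible length between its vertices. -/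
theorem Linked.exists_hasPath (hC : SG.Linked C m) {r : ℕ} (hr : 2 ≤ r) :
    ∀ (F : Finset V) (x y : V), x ∈ C → y ∈ C → x ≠ y → x ∉ F → y ∉ F → r + F.card ≤ m + 2 →
      ∃ ε, SG.HasPath (C \ F) r x y ε := by
  induction r, hr using Nat.le_induction with
  | base =>
    intro F x y hx hy hxy hxF hyF hF
    obtain ⟨z, hz, hzF, hxz, hyz⟩ := hC x hx y hy F (by omega)
    have h := ((HasPath.refl (SG := SG) y).cons (v := z) (by simpa using hyz.ne') hyz.symm).cons
      (v := x) (by simp [hxy, hxz.ne]) hxz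
    refine ⟨_, h.mono ?_⟩
    rintro w (rfl | rfl | rfl) <;> simp_all
  | succ r hr ih =>
    intro F x y hx hy hxy hxF hyF hF
    obtain ⟨z, hz, hzF, hxz, hyz⟩ := hC x hx y hy F (by omega)
    obtain ⟨ε, h⟩ := ih (insert x F) z y hz hy hyz.ne' (by simp [hzF, hxz.ne'])
      (by simp [hyF, hxy.symm]) (by have := Finset.card_insert_le x F; omega)
    refine ⟨_, (h.cons (v := x) (by simp) hxz).mono ?_⟩
    rintro w (rfl | hw)
    · exact ⟨hx, hxF⟩
    · exact ⟨hw.1, fun h => hw.2 (by simpa using Or.inr h)⟩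

/-- In a linked set, two paths of length two with the same ends have the same sign. -/
theorem Linked.square (hC : SG.Linked C m) (hm : 2 ≤ m) (hfree : ¬ SG.HasNegCycleLength (m + 2))
    {x z y y' : V} (hx : x ∈ C) (hz : z ∈ C) (hxy : SG.G.Adj x y) (hyz : SG.G.Adj y z)
    (hxy' : SG.G.Adj x y') (hyz' : SG.G.Adj y' z) :
    SG.sign x y * SG.sign y z = SG.sign x y' * SG.sign y' z := by
  rcases eq_or_ne x z with rfl | hxz
  · rw [SG.sign_symm y, SG.sign_symm y', sign_mul_self hxy, sign_mul_self hxy']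
  obtain ⟨ε, h⟩ := hC.exists_hasPath hm {y, y'} x z hx hz hxz (by simp [hxy.ne, hxy'.ne])
    (by simp [hyz.ne', hyz'.ne']) (by have := Finset.card_le_two (a := y) (b := y'); omega)
  have h1 := h.closed_sign (v := y) hxz (by simp) hxy.symm hyz hfree
  have h2 := h.closed_sign (v := y') hxz (by simp) hxy'.symm hyz' hfree
  rw [SG.sign_symm y x] at h1
  rw [SG.sign_symm y' x] at h2
  rcases h.sign_pm with rfl | rfl <;> linarith

/-- In a linked set, an edge can be replaced by an odd path of the same sign. -/
theorem Linked.exists_odd_hasPath (hC : SG.Linked C m) (hm : 2 ≤ m)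
    (hfree : ¬ SG.HasNegCycleLength (m + 2)) (j : ℕ) :
    ∀ (F : Finset V) (x y : V), x ∈ C → y ∈ C → SG.G.Adj x y → x ∉ F → y ∉ F →
      2 * j + 1 + F.card ≤ m + 1 → SG.HasPath (C \ F) (2 * j + 1) x y (SG.sign x y) := by
  induction j with
  | zero =>
    intro F x y hx hy hxy hxF hyF hF
    have h := (HasPath.refl (SG := SG) y).cons (v := x) (by simpa using hxy.ne) hxy
    rw [mul_one] at h
    refine h.mono ?_
    rintro w (rfl | rfl) <;> simp_all
  | succ j ih =>
    intro F x y hx hy hxy hxF hyF hF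
    obtain ⟨a, ha, haF, hxa, -⟩ := hC x hx x hx (insert y F)
      (by have := Finset.card_insert_le y F; omega)
    obtain ⟨b, hb, hbF, hab, hyb⟩ := hC a ha y hy (insert x F)
      (by have := Finset.card_insert_le x F; omega)
    simp only [Finset.mem_insert, not_or] at haF hbF
    have hsq := hC.square hm hfree ha hy hxa.symm hxy hab hyb.symm
    have h := ih (insert a (insert x F)) b y hb hy hyb.symm (by simp [hab.ne', hbF])
      (by simp [Ne.symm haF.1, hyF, hxy.ne'])
      (by have := Finset.card_insert_le x F
          have := Finset.card_insert_le a (insert x F); omega)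
    have h' := (h.cons (v := a) (by simp) hab).cons (v := x) (by simp [hxa.ne]) hxa
    rw [← hsq, SG.sign_symm a x, ← mul_assoc, sign_mul_self hxa, one_mul] at h'
    refine h'.mono ?_
    rintro w (rfl | rfl | hw)
    · exact ⟨hx, hxF⟩
    · exact ⟨ha, haF.2⟩
    · exact ⟨hw.1, fun h => hw.2 (by simp [Finset.mem_coe.1 h])⟩

theorem Linked.triangle {j : ℕ} (hC : SG.Linked C (2 * j + 1)) (hj : 1 ≤ j)
    (hfree : ¬ SG.HasNegCycleLength (2 * j + 1 + 2)) {a b c : V} (ha : a ∈ C) (hb : b ∈ C)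
    (hab : SG.G.Adj a b) (hca : SG.G.Adj c a) (hcb : SG.G.Adj c b) :
    SG.sign c a * SG.sign a b * SG.sign c b = 1 :=
  (hC.exists_odd_hasPath (by omega) hfree j {c} a b ha hb hab (by simp [hca.ne'])
    (by simp [hcb.ne']) (by simp)).closed_sign hab.ne (by simp) hca hcb hfree

theorem Linked.exists_balancedBy {j : ℕ} (hC : SG.Linked C (2 * j + 1)) (hj : 1 ≤ j)
    (hfree : ¬ SG.HasNegCycleLength (2 * j + 1 + 2)) {r : V} (hr : r ∈ C)
    (hroot : ∀ x ∈ C, ∀ y ∈ C, ∃ z ∈ C, SG.G.Adj r z ∧ SG.G.Adj x z ∧ SG.G.Adj y z) :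
    ∃ s, SG.BalancedBy s C := by
  have hr' : ∀ x : V, ∃ z, x ∈ C → SG.G.Adj r z ∧ SG.G.Adj z x := fun x => by
    by_cases hx : x ∈ C
    · obtain ⟨z, -, h1, h2, -⟩ := hroot x hx x hx
      exact ⟨z, fun _ => ⟨h1, h2.symm⟩⟩
    · exact ⟨x, fun h => absurd h hx⟩
  choose f hf using hr'
  refine ⟨fun x => if x ∈ C then SG.sign r (f x) * SG.sign (f x) x else 1, fun x => ?_, ?_⟩
  · by_cases hx : x ∈ C
    · obtain ⟨h1, h2⟩ := hf x hx
      rcases SG.sign_pm _ _ h1 with h1 | h1 <;> rcases SG.sign_pm _ _ h2 with h2 | h2 <;>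
        simp [hx, h1, h2]
    · simp [hx]
  · intro x hx y hy hxy
    obtain ⟨z, hz, hrz, hxz, hyz⟩ := hroot x hx y hy
    have hsx := hC.square (by omega) hfree hr hx (hf x hx).1 (hf x hx).2 hrz hxz.symm
    have hsy := hC.square (by omega) hfree hr hy (hf y hy).1 (hf y hy).2 hrz hyz.symm
    have ht := hC.triangle hj hfree hx hy hxy hxz.symm hyz.symm
    simp only [hx, hy, if_true, hsx, hsy]
    linear_combination (SG.sign r z * SG.sign r z) * ht + sign_mul_self hrz

theorem BalancedBy.exists_insert {P : Set V} {s : V → ℤ} (hs : SG.BalancedBy s P) {v : V}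
    (hv : v ∉ P) (hfree : ¬ SG.HasNegCycleLength (m + 2))
    (hpath : ∀ a ∈ P, ∀ b ∈ P, a ≠ b → SG.G.Adj v a → SG.G.Adj v b → ∃ ε, SG.HasPath P m a b ε) :
    ∃ s', SG.BalancedBy s' (insert v P) := by
  obtain ⟨t, ht, hadj⟩ : ∃ t : ℤ, (t = 1 ∨ t = -1) ∧
      ∀ b ∈ P, SG.G.Adj v b → t * SG.sign v b * s b = 1 := by
    by_cases hex : ∃ a ∈ P, SG.G.Adj v a
    · obtain ⟨a, ha, hva⟩ := hex
      refine ⟨s a * SG.sign v a, ?_, fun b hb hvb => ?_⟩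
      · rcases hs.1 a with h1 | h1 <;> rcases SG.sign_pm _ _ hva with h2 | h2 <;> simp [h1, h2]
      · rcases eq_or_ne a b with rfl | hab
        · rcases hs.1 a with h1 | h1 <;> rcases SG.sign_pm _ _ hva with h2 | h2 <;> simp [h1, h2]
        · obtain ⟨ε, h⟩ := hpath a ha b hb hab hva hvb
          have h1 := h.closed_sign hab hv hva hvb hfree
          rw [h.sign_eq hs] at h1
          linear_combination h1
    · exact ⟨1, Or.inl rfl, fun b hb hvb => absurd ⟨b, hb, hvb⟩ hex⟩
  have hne : ∀ b ∈ P, b ≠ v := fun b hb h => hv (h ▸ hb)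
  refine ⟨Function.update s v t, fun x => ?_, ?_⟩
  · rcases eq_or_ne x v with rfl | hx
    · simpa using ht
    · simpa [hx] using hs.1 x
  · rintro a (rfl | ha) b (rfl | hb) hab
    · exact absurd rfl hab.ne
    · simpa [hne b hb] using hadj b hb hab
    · have := hadj a ha hab.symm
      simp only [Function.update_self, Function.update_of_ne (hne a ha)]
      rw [SG.sign_symm]
      linear_combination this
    · simpa [hne a ha, hne b hb] using hs.2 a ha b hb hab

theorem Linked.subset_attached (hC : SG.Linked C m) (hm : 1 ≤ m) : C ⊆ SG.attached C := by
  intro x hx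
  obtain ⟨a, ha, -, hxa, -⟩ := hC x hx x hx ∅ (by simp)
  obtain ⟨b, hb, hba, hxb, -⟩ := hC x hx x hx {a} (by simpa using hm)
  exact ⟨a, ha, b, hb, by simpa [eq_comm] using hba, hxa, hxb⟩

/-- Distinct attached vertices have distinct neighbours in `C` other than themselves. -/
theorem Linked.exists_neighbors (hC : SG.Linked C m) (hm : 2 ≤ m) {a b : V}
    (ha : a ∈ SG.attached C) (hb : b ∈ SG.attached C) :
    ∃ a' ∈ C, ∃ b' ∈ C, a' ≠ b' ∧ a' ≠ b ∧ b' ≠ a ∧ SG.G.Adj a a' ∧ SG.G.Adj b b' := by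
  have hne : ∀ x ∈ SG.attached C, ∀ y, ∃ z ∈ C, z ≠ y ∧ SG.G.Adj x z := by
    rintro x ⟨c, hc, c', hc', hcc, h, h'⟩ y
    by_cases hy : c = y
    · exact ⟨c', hc', fun h => hcc (hy.trans h.symm), h'⟩
    · exact ⟨c, hc, hy, h⟩
  have hcore : ∀ x ∈ C, ∀ y z, ∃ w ∈ C, w ≠ y ∧ w ≠ z ∧ SG.G.Adj x w := by
    intro x hx y z
    obtain ⟨w, hw, hwF, h, -⟩ := hC x hx x hx {y, z} (Finset.card_le_two.trans hm)
    simp only [Finset.mem_insert, Finset.mem_singleton, not_or] at hwF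
    exact ⟨w, hw, hwF.1, hwF.2, h⟩
  by_cases haC : a ∈ C
  · obtain ⟨b', hb', hba, h⟩ := hne b hb a
    obtain ⟨a', ha', h1, h2, h'⟩ := hcore a haC b b'
    exact ⟨a', ha', b', hb', h2, h1, hba, h', h⟩
  by_cases hbC : b ∈ C
  · obtain ⟨a', ha', hab, h⟩ := hne a ha b
    obtain ⟨b', hb', h1, h2, h'⟩ := hcore b hbC a a'
    exact ⟨a', ha', b', hb', h2.symm, hab, h1, h, h'⟩
  · obtain ⟨b', hb', -, h⟩ := hne b hb a
    obtain ⟨a', ha', hab, h'⟩ := hne a ha b'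
    exact ⟨a', ha', b', hb', hab, fun e => hbC (e ▸ ha'), fun e => haC (e ▸ hb'), h', h⟩

theorem Linked.exists_hasPath_attached (hC : SG.Linked C m) {q : ℕ} (hq : 2 ≤ q)
    (hqm : q ≤ m) {a b : V} (ha : a ∈ SG.attached C) (hb : b ∈ SG.attached C) (hab : a ≠ b) :
    ∃ ε, SG.HasPath (C ∪ {a, b}) (q + 2) a b ε := by
  obtain ⟨a', ha', b', hb', hab', h1, h2, haa, hbb⟩ := hC.exists_neighbors (by omega) ha hb
  obtain ⟨ε, h⟩ := hC.exists_hasPath hq {a, b} a' b' ha' hb' hab' (by simp [h1, haa.ne'])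
    (by simp [h2, hbb.ne']) (by have := Finset.card_le_two (a := a) (b := b); omega)
  have h' := ((h.cons (v := a) (by simp) haa).symm.cons (v := b)
    (by simp [hab.symm]) hbb).symm
  refine ⟨_, h'.mono ?_⟩
  rintro w (rfl | rfl | hw)
  · simp
  · simp
  · exact Or.inl hw.1

theorem Linked.exists_balancedBy_union (hC : SG.Linked C m) (hm : 4 ≤ m)
    (hfree : ¬ SG.HasNegCycleLength (m + 2)) (hbal : ∃ s, SG.BalancedBy s C) (A : Finset V)
    (hA : (A : Set V) ⊆ SG.attached C) : ∃ s, SG.BalancedBy s (C ∪ A) := by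
  induction A using Finset.induction_on with
  | empty => simpa using hbal
  | insert v A hv ih =>
    rw [Finset.coe_insert, Set.insert_subset_iff] at hA
    obtain ⟨s, hs⟩ := ih hA.2
    rw [Finset.coe_insert, Set.union_insert]
    by_cases hvC : v ∈ C ∪ (A : Set V)
    · rw [Set.insert_eq_of_mem hvC]
      exact ⟨s, hs⟩
    have hsub := Set.union_subset (hC.subset_attached (by omega)) hA.2
    refine hs.exists_insert hvC hfree fun a ha b hb hab _ _ => ?_
    obtain ⟨ε, h⟩ := hC.exists_hasPath_attached (q := m - 2) (by omega) (by omega)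
      (hsub ha) (hsub hb) hab
    rw [show m - 2 + 2 = m by omega] at h
    exact ⟨ε, h.mono (Set.union_subset Set.subset_union_left (by
      rintro w (rfl | rfl) <;> assumption))⟩

theorem Linked.exists_hasPath_in_attached (hC : SG.Linked C m) {q : ℕ} (hq : 4 ≤ q)
    (hqm : q ≤ m) {a b : V} (ha : a ∈ SG.attached C) (hb : b ∈ SG.attached C) (hab : a ≠ b) :
    ∃ ε, SG.HasPath (SG.attached C) q a b ε := by
  obtain ⟨ε, h⟩ := hC.exists_hasPath_attached (q := q - 2) (by omega) (by omega) ha hb hab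
  rw [show q - 2 + 2 = q by omega] at h
  exact ⟨ε, h.mono (Set.union_subset (hC.subset_attached (by omega)) (by
    rintro w (rfl | rfl) <;> assumption))⟩

theorem Linked.exists_balancedBy_insert (hC : SG.Linked C m) (hm : 5 ≤ m)
    (hfree : ¬ SG.HasNegCycleLength (m + 2)) (hbal : ∃ s, SG.BalancedBy s (SG.attached C))
    {u : V} (hu : u ∉ SG.attached C) : ∃ s, SG.BalancedBy s (insert u (SG.attached C)) := by
  obtain ⟨s, hs⟩ := hbal
  exact hs.exists_insert hu hfree fun a ha b hb hab _ _ =>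
    hC.exists_hasPath_in_attached (by omega) le_rfl ha hb hab

theorem Linked.exists_balancedBy_insert_insert (hC : SG.Linked C m) (hm : 5 ≤ m)
    (hfree : ¬ SG.HasNegCycleLength (m + 2)) (hbal : ∃ s, SG.BalancedBy s (SG.attached C))
    {u v : V} (hu : u ∉ SG.attached C) (hv : v ∉ SG.attached C) (huv : u ≠ v)
    (hnb : SG.G.Adj v u → ∀ b ∈ SG.attached C, SG.G.Adj v b →
      ∃ a ∈ SG.attached C, SG.G.Adj u a ∧ a ≠ b) :
    ∃ s, SG.BalancedBy s (insert v (insert u (SG.attached C))) := by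
  obtain ⟨s, hs⟩ := hC.exists_balancedBy_insert hm hfree hbal hu
  have key : SG.G.Adj v u → ∀ b ∈ SG.attached C, SG.G.Adj v b →
      ∃ ε, SG.HasPath (insert u (SG.attached C)) m u b ε := by
    intro hvu b hb hvb
    obtain ⟨a, ha, hua, hab⟩ := hnb hvu b hb hvb
    obtain ⟨ε, h⟩ := hC.exists_hasPath_in_attached (q := m - 1) (by omega) (by omega) ha hb hab
    have h' := h.cons hu hua
    rw [show m - 1 + 1 = m by omega] at h'
    exact ⟨_, h'⟩
  refine hs.exists_insert (by simp [hv, huv.symm]) hfree ?_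
  rintro a (rfl | ha) b (rfl | hb) hab hva hvb
  · exact absurd rfl hab
  · exact key hva b hb hvb
  · obtain ⟨ε, h⟩ := key hvb a ha hva
    exact ⟨ε, h.symm⟩
  · obtain ⟨ε, h⟩ := hC.exists_hasPath_in_attached (by omega) le_rfl ha hb hab
    exact ⟨ε, h.mono (Set.subset_insert _ _)⟩

theorem BalancedBy.balanced {P : Set V} {s : V → ℤ} (hs : SG.BalancedBy s P)
    (hP : ∀ x, x ∈ P) : SG.Balanced :=
  ⟨s, hs.1, fun u v h => hs.2 u (hP u) v (hP v) h⟩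

/-- A signed graph with a linked set missing at most two attached vertices is balanced, unless
these two vertices form a pendant triangle. -/
theorem Linked.balanced [Finite V] (hC : SG.Linked C m) (hm : 5 ≤ m)
    (hfree : ¬ SG.HasNegCycleLength (m + 2)) (hbal : ∃ s, SG.BalancedBy s C)
    (hout : ∀ u ∉ SG.attached C, ∀ v ∉ SG.attached C, ∀ w ∉ SG.attached C,
      u = v ∨ u = w ∨ v = w)
    (hpend : ∀ u v a, SG.G.Adj u v → ∃ w, w ≠ u ∧ w ≠ v ∧ w ≠ a ∧
      (SG.G.Adj u w ∨ SG.G.Adj v w)) : SG.Balanced := by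
  have hbalP : ∃ s, SG.BalancedBy s (SG.attached C) := by
    have h := hC.exists_balancedBy_union (by omega) hfree hbal
      (Set.toFinite (SG.attached C)).toFinset (by simp)
    rwa [Set.Finite.coe_toFinset,
      Set.union_eq_self_of_subset_left (hC.subset_attached (by omega))] at h
  by_cases h0 : ∀ x, x ∈ SG.attached C
  · obtain ⟨s, hs⟩ := hbalP
    exact hs.balanced h0
  push Not at h0
  obtain ⟨u, hu⟩ := h0
  by_cases h1 : ∀ x ∉ SG.attached C, x = u
  · obtain ⟨s, hs⟩ := hC.exists_balancedBy_insert hm hfree hbalP hu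
    exact hs.balanced fun x => by
      by_cases hx : x ∈ SG.attached C
      · exact Or.inr hx
      · exact Or.inl (h1 x hx)
  push Not at h1
  obtain ⟨v, hv, hvu⟩ := h1
  have hcov : ∀ x, x = u ∨ x = v ∨ x ∈ SG.attached C := fun x => by
    by_contra! hx
    rcases hout u hu v hv x hx.2.2 with h | h | h
    · exact hvu h.symm
    · exact hx.1 h.symm
    · exact hx.2.1 h.symm
  by_cases huv : SG.G.Adj v u → ∀ b ∈ SG.attached C, SG.G.Adj v b →
      ∃ a ∈ SG.attached C, SG.G.Adj u a ∧ a ≠ b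
  · obtain ⟨s, hs⟩ := hC.exists_balancedBy_insert_insert hm hfree hbalP hu hv hvu.symm huv
    exact hs.balanced fun x => by
      rcases hcov x with h | h | h <;> simp [h]
  by_cases hvu' : SG.G.Adj u v → ∀ b ∈ SG.attached C, SG.G.Adj u b →
      ∃ a ∈ SG.attached C, SG.G.Adj v a ∧ a ≠ b
  · obtain ⟨s, hs⟩ := hC.exists_balancedBy_insert_insert hm hfree hbalP hv hu hvu hvu'
    exact hs.balanced fun x => by
      rcases hcov x with h | h | h <;> simp [h]
  push Not at huv hvu'
  obtain ⟨hadj, b, hb, hvb, hub⟩ := huv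
  obtain ⟨-, a, ha, hua, hva⟩ := hvu'
  obtain rfl := hub a ha hua
  obtain ⟨w, hwu, hwv, hwa, hw⟩ := hpend u v a hadj.symm
  have hwP : w ∈ SG.attached C := by
    rcases hcov w with h | h | h
    · exact absurd h hwu
    · exact absurd h hwv
    · exact h
  rcases hw with hw | hw
  · exact absurd (hub w hwP hw) hwa
  · exact absurd (hva w hwP hw) hwa

end Core

end SignedGraph

section Counting

variable {V : Type*} [Fintype V] (G : SimpleGraph V)

/-- The vertices not adjacent to `v`, including `v` itself. -/
noncomputable def nonNeighbors (v : V) : Finset V := {w | ¬ G.Adj v w}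

/-- The vertices with at most seven non-neighbours besides themselves. -/
noncomputable def denseCore : Finset V := {v | (nonNeighbors G v).card ≤ 8}

variable {G}

theorem mem_nonNeighbors {v w : V} : w ∈ nonNeighbors G v ↔ ¬ G.Adj v w := by
  simp [nonNeighbors]

theorem mem_denseCore {v : V} : v ∈ denseCore G ↔ (nonNeighbors G v).card ≤ 8 := by
  simp [denseCore]

theorem self_mem_nonNeighbors (v : V) : v ∈ nonNeighbors G v := by
  simp [nonNeighbors]

theorem sum_card_nonNeighbors :
    ∑ v, (nonNeighbors G v).card + 2 * G.edgeSet.ncard = Fintype.card V * Fintype.card V := by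
  have h : ∀ v, (nonNeighbors G v).card + G.degree v = Fintype.card V := fun v => by
    have h := Finset.card_filter_add_card_filter_not (s := Finset.univ) (G.Adj v)
    rw [← SimpleGraph.neighborFinset_eq_filter, SimpleGraph.card_neighborFinset_eq_degree,
      Finset.card_univ] at h
    rw [nonNeighbors]
    omega
  rw [Set.ncard_eq_toFinset_card', show G.edgeSet.toFinset = G.edgeFinset from rfl,
    ← G.sum_degrees_eq_twice_card_edges,
    ← Finset.sum_add_distrib, Finset.sum_congr rfl fun v _ => h v]
  simp

theorem card_compl_denseCore (h : ∑ v, (nonNeighbors G v).card + 14 ≤ 5 * Fintype.card V) :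
    8 * (denseCore G)ᶜ.card + 14 ≤ 4 * Fintype.card V := by
  have h1 := Finset.card_nsmul_le_sum (denseCore G) (fun v => (nonNeighbors G v).card) 1
    fun v _ => Finset.card_pos.2 ⟨v, self_mem_nonNeighbors v⟩
  have h2 := Finset.card_nsmul_le_sum (denseCore G)ᶜ (fun v => (nonNeighbors G v).card) 9
    fun v hv => by
      rw [Finset.mem_compl, mem_denseCore] at hv
      omega
  have h3 := Finset.sum_add_sum_compl (denseCore G) fun v => (nonNeighbors G v).card
  have h4 := Finset.card_add_card_compl (denseCore G)
  simp only [smul_eq_mul] at h1 h2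
  omega

theorem exists_adj_of_card_lt {D F : Finset V} {x y : V}
    (h : Dᶜ.card + F.card + (nonNeighbors G x).card + (nonNeighbors G y).card < Fintype.card V) :
    ∃ z ∈ D, z ∉ F ∧ G.Adj x z ∧ G.Adj y z := by
  have hlt : (Dᶜ ∪ F ∪ nonNeighbors G x ∪ nonNeighbors G y).card < Fintype.card V := by
    refine lt_of_le_of_lt (Finset.card_union_le _ _) (lt_of_le_of_lt ?_ h)
    gcongr
    refine (Finset.card_union_le _ _).trans ?_
    gcongr
    exact Finset.card_union_le _ _
  obtain ⟨z, hz⟩ := Finset.exists_mem_notMem_of_card_lt_card (hlt.trans_eq Finset.card_univ.symm)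
  simp only [Finset.mem_union, Finset.mem_compl, mem_nonNeighbors, not_or, not_not] at hz
  exact ⟨z, hz.2.1.1.1, hz.2.1.1.2, hz.2.1.2, hz.2.2⟩

theorem exists_card_nonNeighbors_le
    (h : ∑ v, (nonNeighbors G v).card + 14 ≤ 5 * Fintype.card V) :
    ∃ r, (nonNeighbors G r).card ≤ 4 := by
  by_contra! hr
  have := Finset.card_nsmul_le_sum Finset.univ (fun v => (nonNeighbors G v).card) 5
    fun v _ => hr v
  rw [Finset.card_univ, smul_eq_mul] at this
  omega

/-- No three vertices outside the dense core each have at most one neighbour in it. -/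
theorem card_ne_three_of_few_neighbors (hn : 10 ≤ Fintype.card V)
    (h : ∑ v, (nonNeighbors G v).card + 14 ≤ 5 * Fintype.card V) {T : Finset V}
    (hTC : Disjoint (denseCore G) T)
    (hT : ∀ t ∈ T, (denseCore G).card ≤ (denseCore G ∩ nonNeighbors G t).card + 1) :
    T.card ≠ 3 := by
  intro hT3
  set D := denseCore G with hD
  have hcross : ∑ t ∈ T, (D ∩ nonNeighbors G t).card = ∑ c ∈ D, (T ∩ nonNeighbors G c).card := by
    have := Finset.sum_card_bipartiteAbove_eq_sum_card_bipartiteBelow (s := T) (t := D)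
      fun a b => ¬ G.Adj a b
    convert this using 2 with t ht c hc
    · congr 1; ext; simp [mem_nonNeighbors, Finset.mem_bipartiteAbove]
    · congr 1; ext; simp [mem_nonNeighbors, Finset.mem_bipartiteBelow, G.adj_comm]
  have h1 : ∑ c ∈ D, ((T ∩ nonNeighbors G c).card + 1) ≤ ∑ c ∈ D, (nonNeighbors G c).card := by
    refine Finset.sum_le_sum fun c hc => ?_
    rw [← Finset.card_insert_of_notMem (a := c)
      fun h => Finset.disjoint_left.1 hTC hc (Finset.mem_inter.1 h).1]
    exact Finset.card_le_card
      (Finset.insert_subset (self_mem_nonNeighbors c) Finset.inter_subset_right)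
  have h2 : ∑ t ∈ T, (D ∩ nonNeighbors G t).card ≤ ∑ t ∈ T, (nonNeighbors G t).card :=
    Finset.sum_le_sum fun t _ => Finset.card_le_card Finset.inter_subset_right
  have h3 : ∑ t ∈ T, D.card ≤ ∑ t ∈ T, ((D ∩ nonNeighbors G t).card + 1) :=
    Finset.sum_le_sum hT
  have hsub : T ⊆ Dᶜ := fun t ht => Finset.mem_compl.2 fun h => Finset.disjoint_left.1 hTC h ht
  have h4 := Finset.card_nsmul_le_sum (Dᶜ \ T) (fun v => (nonNeighbors G v).card) 9 fun v hv => by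
    rw [Finset.mem_sdiff, Finset.mem_compl, hD, mem_denseCore] at hv
    omega
  have h5 := Finset.sum_sdiff hsub (f := fun v => (nonNeighbors G v).card)
  have h6 := Finset.sum_add_sum_compl D fun v => (nonNeighbors G v).card
  have h7 := Finset.card_sdiff_add_card_eq_card hsub
  have h8 := Finset.card_add_card_compl D
  simp only [Finset.sum_add_distrib, Finset.sum_const, smul_eq_mul, mul_one, hT3] at h1 h3 h4
  omega

theorem exists_adj_of_sum_card_nonNeighbors
    (h : ∑ v, (nonNeighbors G v).card + 14 ≤ 5 * Fintype.card V) {u v : V} (a : V)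
    (huv : u ≠ v) : ∃ w, w ≠ u ∧ w ≠ v ∧ w ≠ a ∧ (G.Adj u w ∨ G.Adj v w) := by
  by_contra! hw
  set R : Finset V := {u, v, a}ᶜ with hR
  have hRmem : ∀ {w}, w ∈ R ↔ w ≠ u ∧ w ≠ v ∧ w ≠ a := by simp [hR]
  have hRcard : Fintype.card V ≤ R.card + 3 := by
    have hcompl := Finset.card_add_card_compl ({u, v, a} : Finset V)
    rw [← hR] at hcompl
    have := Finset.card_le_three (a := u) (b := v) (c := a)
    omega
  have hends : ∀ x ∈ ({u, v} : Finset V), R.card + 1 ≤ (nonNeighbors G x).card := by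
    intro x hx
    rw [Finset.mem_insert, Finset.mem_singleton] at hx
    rw [← Finset.card_insert_of_notMem (s := R) (a := x)
      (by rcases hx with rfl | rfl <;> simp [hRmem])]
    refine Finset.card_le_card (Finset.insert_subset (self_mem_nonNeighbors x) fun w hwR => ?_)
    obtain ⟨h1, h2, h3⟩ := hRmem.1 hwR
    rw [mem_nonNeighbors]
    rcases hx with rfl | rfl
    · exact (hw w h1 h2 h3).1
    · exact (hw w h1 h2 h3).2
  have hrest : ∀ w ∈ R, 3 ≤ (nonNeighbors G w).card := by
    intro w hwR
    obtain ⟨h1, h2, h3⟩ := hRmem.1 hwR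
    have h4 := hw w h1 h2 h3
    rw [← Finset.card_eq_three.2 ⟨w, u, v, h1, h2, huv, rfl⟩]
    refine Finset.card_le_card ?_
    simp only [Finset.insert_subset_iff, Finset.singleton_subset_iff, mem_nonNeighbors,
      G.adj_comm w]
    exact ⟨G.irrefl, h4⟩
  have hdisj : Disjoint R {u, v} := by
    rw [Finset.disjoint_left]
    intro w hwR
    simp [(hRmem.1 hwR).1, (hRmem.1 hwR).2.1]
  have h1 := Finset.card_nsmul_le_sum _ _ _ hends
  have h2 := Finset.card_nsmul_le_sum _ _ _ hrest
  have h3 := Finset.sum_le_sum_of_subset (f := fun x => (nonNeighbors G x).card)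
    (Finset.subset_univ (R ∪ {u, v}))
  rw [Finset.sum_union hdisj] at h3
  rw [Finset.card_pair huv, smul_eq_mul] at h1
  rw [smul_eq_mul] at h2
  omega

end Counting

namespace SignedGraph

/-- A dense signed graph without negative cycles of length `2 * k + 1` is balanced. -/
theorem balanced_of_sum_card_nonNeighbors {V : Type*} [Fintype V] {SG : SignedGraph V} {k : ℕ}
    (hk : 3 ≤ k) (hkn : 10 * k + 10 ≤ Fintype.card V)
    (hfree : ¬ SG.HasNegCycleLength (2 * k + 1))
    (h : ∑ v, (nonNeighbors SG.G v).card + 14 ≤ 5 * Fintype.card V) : SG.Balanced := by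
  obtain ⟨j, rfl⟩ : ∃ j, k = j + 1 := ⟨k - 1, by omega⟩
  have hcard := card_compl_denseCore h
  have hC : SG.Linked (denseCore SG.G : Set V) (2 * j + 1) := by
    intro x hx y hy F hF
    rw [Finset.mem_coe, mem_denseCore] at hx hy
    exact exists_adj_of_card_lt (by omega)
  have hsub := hC.subset_attached (by omega)
  obtain ⟨r, hr⟩ := exists_card_nonNeighbors_le h
  have hroot : ∀ x ∈ (denseCore SG.G : Set V), ∀ y ∈ (denseCore SG.G : Set V),
      ∃ z ∈ (denseCore SG.G : Set V), SG.G.Adj r z ∧ SG.G.Adj x z ∧ SG.G.Adj y z := by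
    intro x hx y hy
    rw [Finset.mem_coe, mem_denseCore] at hx hy
    obtain ⟨z, hz, hrz, h1, h2⟩ := exists_adj_of_card_lt (G := SG.G) (D := denseCore SG.G)
      (F := nonNeighbors SG.G r) (x := x) (y := y) (by omega)
    rw [mem_nonNeighbors, not_not] at hrz
    exact ⟨z, hz, hrz, h1, h2⟩
  have hbal := hC.exists_balancedBy (by omega) hfree
    (Finset.mem_coe.2 (mem_denseCore.2 (by omega : (nonNeighbors SG.G r).card ≤ 8))) hroot
  have hfew : ∀ t ∉ SG.attached (denseCore SG.G : Set V),
      (denseCore SG.G).card ≤ (denseCore SG.G ∩ nonNeighbors SG.G t).card + 1 := by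
    intro t ht
    rw [← Finset.card_sdiff_add_card_inter (denseCore SG.G) (nonNeighbors SG.G t), add_comm]
    gcongr
    rw [Finset.card_le_one]
    intro c hc c' hc'
    rw [Finset.mem_sdiff, mem_nonNeighbors, not_not] at hc hc'
    by_contra hne
    exact ht ⟨c, hc.1, c', hc'.1, hne, hc.2, hc'.2⟩
  refine hC.balanced (by omega) hfree hbal (fun u hu v hv w hw => ?_)
    fun u v a huv => exists_adj_of_sum_card_nonNeighbors h a huv.ne
  by_contra! hne
  have hT : ∀ t ∈ ({u, v, w} : Finset V), t ∉ SG.attached (denseCore SG.G : Set V) := by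
    simp [hu, hv, hw]
  exact card_ne_three_of_few_neighbors (by omega) h
    (Finset.disjoint_left.2 fun c hc hcT => hT c hcT (hsub hc)) (fun t ht => hfew t (hT t ht))
    (Finset.card_eq_three.2 ⟨u, v, w, hne.1, hne.2.1, hne.2.2, rfl⟩)

end SignedGraph

/-- Turán bound for `C_{2k+1}^-`-free unbalanced signed graphs. -/
theorem unbalanced_C2k1_free_edge_bound {V : Type*} [Fintype V] (n k : ℕ)
    (SG : SignedGraph V) (hn : Fintype.card V = n)
    (hk : 3 ≤ k) (hkn : (k : ℝ) ≤ (n : ℝ) / 10 - 1)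
    (hunb : SG.Unbalanced) (hfree : ¬ SG.HasNegCycleLength (2 * k + 1)) :
    (SG.edgeCount : ℝ) ≤ (n : ℝ) * ((n : ℝ) - 1) / 2 - 2 * ((n : ℝ) - 3) := by
  by_contra! hlt
  subst hn
  set N := Fintype.card V with hN
  have hkN : 10 * k + 10 ≤ N := by
    have : (10 * k + 10 : ℝ) ≤ N := by linarith
    exact_mod_cast this
  refine hunb (SignedGraph.balanced_of_sum_card_nonNeighbors hk hkN hfree ?_)
  have hsum := sum_card_nonNeighbors (G := SG.G)
  rw [← hN] at hsum ⊢
  have hedge : N * N + 12 < 2 * SG.edgeCount + 5 * N := by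
    have : (N * N + 12 : ℝ) < 2 * SG.edgeCount + 5 * N := by linarith
    exact_mod_cast this
  have hpar : 2 ∣ N * N + 5 * N := by
    rcases Nat.even_or_odd' N with ⟨c, hc | hc⟩
    · exact ⟨2 * c * c + 5 * c, by rw [hc]; ring⟩
    · exact ⟨2 * c * c + 7 * c + 3, by rw [hc]; ring⟩
  rw [SignedGraph.edgeCount] at hedge
  generalize N * N = q at *
  omega
end

section
/- Let Ġ = (G, σ) be an unbalanced signed graph of order n. If e(Ġ) ≥ n(n−1)/2 − 2(n−3), then Ġ contains a negative cycle of length at most 4 (i.e., a negative cycle of length 3 or 4). -/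
open scoped Classical

namespace SimpleGraph

variable {V : Type*} (H : SimpleGraph V)

/-- The number of ordered pairs `(x, y)` with `x ∈ A`, `y ∈ B` adjacent in `H`. -/
noncomputable def adjPairs (A B : Finset V) : ℕ :=
  ∑ x ∈ A, ∑ y ∈ B, if H.Adj x y then 1 else 0

lemma adjPairs_comm (A B : Finset V) : H.adjPairs A B = H.adjPairs B A := by
  unfold adjPairs
  rw [Finset.sum_comm]
  simp only [H.adj_comm]

lemma adjPairs_union_left {A B : Finset V} (h : Disjoint A B) (C : Finset V) :
    H.adjPairs (A ∪ B) C = H.adjPairs A C + H.adjPairs B C :=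
  Finset.sum_union h

lemma adjPairs_union_right {B C : Finset V} (h : Disjoint B C) (A : Finset V) :
    H.adjPairs A (B ∪ C) = H.adjPairs A B + H.adjPairs A C := by
  rw [adjPairs_comm, adjPairs_union_left H h, adjPairs_comm, H.adjPairs_comm C]

lemma adjPairs_union_self {A B : Finset V} (h : Disjoint A B) :
    H.adjPairs (A ∪ B) (A ∪ B) =
      H.adjPairs A A + H.adjPairs B B + 2 * H.adjPairs A B := by
  rw [adjPairs_union_left H h, adjPairs_union_right H h, adjPairs_union_right H h,
    H.adjPairs_comm B A]
  ring

lemma adjPairs_eq_mul {A B : Finset V} (h : ∀ x ∈ A, ∀ y ∈ B, H.Adj x y) :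
    H.adjPairs A B = A.card * B.card := by
  unfold adjPairs
  rw [Finset.sum_congr rfl fun x hx => Finset.sum_congr rfl fun y hy => if_pos (h x hx y hy)]
  simp

lemma adjPairs_singleton (v : V) [DecidablePred (H.Adj v)] (A : Finset V) :
    H.adjPairs {v} A = (A.filter (H.Adj v)).card := by
  simp only [adjPairs, Finset.sum_singleton, Finset.card_filter]
  exact Finset.sum_congr rfl fun x _ => by congr

/-- Splitting the ordered adjacent pairs in a finite set according to whether they use `v`. -/
lemma adjPairs_self_eq_erase {S : Finset V} {v : V} [DecidablePred (H.Adj v)] (hv : v ∈ S) :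
    H.adjPairs S S = H.adjPairs (S.erase v) (S.erase v) +
      2 * ((S.erase v).filter (H.Adj v)).card := by
  have hS : S = {v} ∪ S.erase v := by
    ext x; by_cases h : x = v <;> simp [h, hv]
  have hd : Disjoint ({v} : Finset V) (S.erase v) := by simp
  conv_lhs => rw [hS]
  rw [adjPairs_union_self H hd, adjPairs_singleton, adjPairs_singleton]
  simp [Finset.filter_singleton]

lemma adjPairs_compl_univ [Fintype V] :
    Hᶜ.adjPairs Finset.univ Finset.univ + 2 * H.edgeSet.ncard + Fintype.card V =
      Fintype.card V * Fintype.card V := by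
  have h1 : H.edgeSet.ncard = H.edgeFinset.card := by
    rw [← coe_edgeFinset, Set.ncard_coe_finset]
  have h2 : Hᶜ.adjPairs Finset.univ Finset.univ = ∑ x, Hᶜ.degree x := by
    refine Finset.sum_congr rfl fun x _ => ?_
    rw [← card_neighborFinset_eq_degree, neighborFinset_eq_filter]
    simp
  rw [h1, h2, ← sum_degrees_eq_twice_card_edges, ← Finset.sum_add_distrib]
  have h3 : ∀ x, Hᶜ.degree x + H.degree x + 1 = Fintype.card V := by
    intro x
    have := H.degree_lt_card_verts x
    rw [degree_compl]
    omega
  calc (∑ x, (Hᶜ.degree x + H.degree x)) + Fintype.card V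
      = ∑ x, (Hᶜ.degree x + H.degree x + 1) := by
        rw [Finset.sum_add_distrib (g := fun _ => 1)]; simp
    _ = _ := by simp only [h3]; simp

/-- If `S` is partitioned into `{v}` and nonempty sets `A`, `B`, `C`, `D`, and `H` contains all
edges between `A` and `B`, `A` and `D`, `B` and `C`, and `v` and `C ∪ D`, then `S` spans at least
`2 |S| - 5` edges of `H`. -/
lemma card_le_adjPairs_of_partition {S A B C D : Finset V} {v : V} (hv : v ∈ S)
    (hS : S.erase v = (A ∪ B) ∪ (C ∪ D)) (dAB : Disjoint A B) (dCD : Disjoint C D)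
    (dABCD : Disjoint (A ∪ B) (C ∪ D)) (hA : A.Nonempty) (hB : B.Nonempty) (hC : C.Nonempty)
    (hD : D.Nonempty) (hAB : ∀ x ∈ A, ∀ y ∈ B, H.Adj x y) (hAD : ∀ x ∈ A, ∀ y ∈ D, H.Adj x y)
    (hBC : ∀ x ∈ B, ∀ y ∈ C, H.Adj x y) (hvCD : ∀ x ∈ C ∪ D, H.Adj v x) :
    4 * S.card ≤ H.adjPairs S S + 10 := by
  have hdeg : C.card + D.card ≤ ((S.erase v).filter (H.Adj v)).card := by
    rw [← Finset.card_union_of_disjoint dCD, hS]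
    exact Finset.card_le_card fun x hx =>
      Finset.mem_filter.2 ⟨Finset.mem_union_right _ hx, hvCD x hx⟩
  have hcard : S.card = A.card + B.card + (C.card + D.card) + 1 := by
    rw [← Finset.card_erase_add_one hv, hS, Finset.card_union_of_disjoint dABCD,
      Finset.card_union_of_disjoint dAB, Finset.card_union_of_disjoint dCD]
  have hsplit := H.adjPairs_self_eq_erase hv
  have herase := H.adjPairs_union_self dABCD
  rw [← hS, H.adjPairs_union_self dAB, H.adjPairs_union_left dAB (C ∪ D),
    H.adjPairs_union_right dCD A, H.adjPairs_union_right dCD B, H.adjPairs_eq_mul hAB,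
    H.adjPairs_eq_mul hAD, H.adjPairs_eq_mul hBC] at herase
  obtain ⟨p, hp⟩ := Nat.exists_eq_add_of_lt hA.card_pos
  obtain ⟨q, hq⟩ := Nat.exists_eq_add_of_lt hB.card_pos
  obtain ⟨r, hr⟩ := Nat.exists_eq_add_of_lt hC.card_pos
  obtain ⟨t, ht⟩ := Nat.exists_eq_add_of_lt hD.card_pos
  rw [hp, hq, hr, ht] at herase hcard
  rw [hr, ht] at hdeg
  ring_nf at herase hcard hdeg
  have := Nat.zero_le (p * q)
  have := Nat.zero_le (p * t)
  have := Nat.zero_le (q * r)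
  linarith

end SimpleGraph

namespace SignedGraph

variable {V : Type*} (SG : SignedGraph V)

lemma sign_triangle (h3 : ¬ SG.HasNegCycleLength 3) {a b c : V} (hab : SG.G.Adj a b)
    (hbc : SG.G.Adj b c) (hca : SG.G.Adj c a) :
    SG.sign a b * SG.sign b c * SG.sign c a = 1 := by
  by_contra hne
  refine h3 ⟨a, .cons hab (.cons hbc (.cons hca .nil)), ?_, rfl, ?_⟩
  · have := hab.ne
    have := hbc.ne
    have := hca.ne
    simp [SimpleGraph.Walk.isCycle_def, SimpleGraph.Walk.isTrail_def]
    grind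
  · simp only [walkSign, SimpleGraph.Walk.edges_cons, SimpleGraph.Walk.edges_nil, edgeSign,
      List.map_cons, List.map_nil, List.prod_cons, List.prod_nil, Sym2.lift_mk]
    rcases SG.sign_pm _ _ hab with h | h <;> rcases SG.sign_pm _ _ hbc with h' | h' <;>
      rcases SG.sign_pm _ _ hca with h'' | h'' <;> simp_all

lemma sign_quadrilateral (h4 : ¬ SG.HasNegCycleLength 4) {a b c d : V} (hab : SG.G.Adj a b)
    (hbc : SG.G.Adj b c) (hcd : SG.G.Adj c d) (hda : SG.G.Adj d a) (hac : a ≠ c) (hbd : b ≠ d) :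
    SG.sign a b * SG.sign b c * SG.sign c d * SG.sign d a = 1 := by
  by_contra hne
  refine h4 ⟨a, .cons hab (.cons hbc (.cons hcd (.cons hda .nil))), ?_, rfl, ?_⟩
  · have := hab.ne
    have := hbc.ne
    have := hcd.ne
    have := hda.ne
    simp [SimpleGraph.Walk.isCycle_def, SimpleGraph.Walk.isTrail_def]
    grind
  · simp only [walkSign, SimpleGraph.Walk.edges_cons, SimpleGraph.Walk.edges_nil, edgeSign,
      List.map_cons, List.map_nil, List.prod_cons, List.prod_nil, Sym2.lift_mk]
    rcases SG.sign_pm _ _ hab with h | h <;> rcases SG.sign_pm _ _ hbc with h' | h' <;>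
      rcases SG.sign_pm _ _ hcd with h'' | h'' <;> rcases SG.sign_pm _ _ hda with h''' | h''' <;>
      simp_all

/-- The subgraph induced on `S` is balanced. -/
def BalancedOn (S : Finset V) : Prop :=
  ∃ s : V → ℤ, (∀ x, s x = 1 ∨ s x = -1) ∧
    ∀ u ∈ S, ∀ v ∈ S, SG.G.Adj u v → s u * SG.sign u v * s v = 1

/-- Without negative triangles and quadrilaterals, a vertex set in which some vertex `v` has at
most one non-neighbour `w` induces a balanced subgraph. -/
lemma balancedOn_of_forall_adj (h3 : ¬ SG.HasNegCycleLength 3) (h4 : ¬ SG.HasNegCycleLength 4)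
    {S : Finset V} {v w : V} (h : ∀ x ∈ S, x ≠ v → x ≠ w → SG.G.Adj v x) :
    SG.BalancedOn S := by
  wlog hvw : ¬ SG.G.Adj v w generalizing w
  · refine this (w := v) (fun x hx hxv _ => ?_) SG.G.irrefl
    by_cases hxw : x = w
    · exact hxw ▸ not_not.1 hvw
    · exact h x hx hxv hxw
  obtain ⟨ε, hε, hw⟩ : ∃ ε : ℤ, (ε = 1 ∨ ε = -1) ∧
      ∀ x ∈ S, w ≠ v → x ≠ v → SG.G.Adj w x → ε * SG.sign w x * SG.sign v x = 1 := by
    by_cases hx : ∃ x ∈ S, w ≠ v ∧ x ≠ v ∧ SG.G.Adj w x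
    · obtain ⟨x, hxS, hwv, hxv, hwx⟩ := hx
      have hvx := h x hxS hxv hwx.ne'
      refine ⟨SG.sign w x * SG.sign v x, ?_, ?_⟩
      · rcases SG.sign_pm _ _ hwx with h | h <;> rcases SG.sign_pm _ _ hvx with h' | h' <;>
          simp [h, h']
      · intro y hyS _ hyv hwy
        have hvy := h y hyS hyv hwy.ne'
        by_cases hxy : x = y
        · subst hxy
          rcases SG.sign_pm _ _ hwx with h | h <;> rcases SG.sign_pm _ _ hvx with h' | h' <;>
            simp [h, h']
        · have := SG.sign_quadrilateral h4 hvx hwx.symm hwy hvy.symm hwv.symm hxy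
          rw [SG.sign_symm x w, SG.sign_symm y v] at this
          linarith
    · push Not at hx
      exact ⟨1, .inl rfl, fun x hxS h1 h2 h3 => absurd h3 (hx x hxS h1 h2)⟩
  have hcases : ∀ x, SG.G.Adj v x → SG.sign v x = 1 ∨ SG.sign v x = -1 := SG.sign_pm v
  let s : V → ℤ := fun x =>
    if x = v then 1 else if x = w then ε else if SG.G.Adj v x then SG.sign v x else 1
  have hsv : s v = 1 := by simp [s]
  have hsw : w ≠ v → s w = ε := fun h => by simp [s, h]
  have hsx : ∀ x ∈ S, x ≠ v → x ≠ w → s x = SG.sign v x := fun x hx h1 h2 => by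
    simp [s, h1, h2, h x hx h1 h2]
  have hs : ∀ x, s x = 1 ∨ s x = -1 := by
    intro x
    simp only [s]
    split_ifs with h1 h2 h3
    exacts [.inl rfl, hε, hcases x h3, .inl rfl]
  have hvx : ∀ x ∈ S, SG.G.Adj v x → s v * SG.sign v x * s x = 1 := by
    intro x hx hvx
    have hxw : x ≠ w := by
      rintro rfl
      exact hvw hvx
    rw [hsv, hsx x hx hvx.ne' hxw]
    rcases hcases x hvx with h | h <;> simp [h]
  have hwx : w ≠ v → ∀ x ∈ S, x ≠ v → SG.G.Adj w x → s w * SG.sign w x * s x = 1 := by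
    intro hwv x hx hxv hwx
    rw [hsw hwv, hsx x hx hxv hwx.ne']
    exact hw x hx hwv hxv hwx
  have hsymm : ∀ x y, s x * SG.sign x y * s y = s y * SG.sign y x * s x := fun x y => by
    rw [SG.sign_symm x y]
    ring
  refine ⟨s, hs, fun x hx y hy hxy => ?_⟩
  by_cases hxv : x = v
  · subst hxv
    exact hvx y hy hxy
  by_cases hyv : y = v
  · subst hyv
    rw [hsymm]
    exact hvx x hx hxy.symm
  by_cases hxw : x = w
  · subst hxw
    exact hwx hxv y hy hyv hxy
  by_cases hyw : y = w
  · subst hyw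
    rw [hsymm]
    exact hwx hyv x hx hxv hxy.symm
  rw [hsx x hx hxv hxw, hsx y hy hyv hyw, SG.sign_symm v y]
  exact SG.sign_triangle h3 (h x hx hxv hxw) hxy (h y hy hyv hyw).symm

/-- If deleting `v` leaves a subgraph balanced by `s`, and a vertex set `T` separates the
neighbours of `v` according to their sign with no edge leaving `T`, then the whole
subgraph is balanced. -/
lemma balancedOn_of_separation {S : Finset V} {v : V} {s : V → ℤ}
    (hs : ∀ x, s x = 1 ∨ s x = -1)
    (hbal : ∀ x ∈ S.erase v, ∀ y ∈ S.erase v, SG.G.Adj x y → s x * SG.sign x y * s y = 1)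
    (T : V → Prop)
    (hT : ∀ x ∈ S.erase v, ∀ y ∈ S.erase v, T x → ¬ T y → ¬ SG.G.Adj x y)
    (hN : ∀ x ∈ S.erase v, SG.G.Adj v x → (T x ↔ s x * SG.sign v x = -1)) :
    SG.BalancedOn S := by
  let t : V → ℤ := fun x => if x = v then 1 else if T x then - s x else s x
  have htv : t v = 1 := by simp [t]
  have ht : ∀ x, x ≠ v → t x = if T x then - s x else s x := fun x h => by simp [t, h]
  have hv : ∀ x ∈ S.erase v, SG.G.Adj v x → t x * SG.sign v x = 1 := by
    intro x hx hvx
    rw [ht x (Finset.ne_of_mem_erase hx)]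
    have := hN x hx hvx
    rcases SG.sign_pm _ _ hvx with h | h <;> rcases hs x with h' | h' <;> simp_all
  refine ⟨t, fun x => ?_, fun x hx y hy hxy => ?_⟩
  · rcases hs x with h | h <;> simp only [t] <;> split_ifs <;> simp [h]
  · by_cases hxv : x = v
    · subst hxv
      rw [htv, one_mul, mul_comm]
      exact hv y (Finset.mem_erase.2 ⟨hxy.ne', hy⟩) hxy
    · have hx' := Finset.mem_erase.2 ⟨hxv, hx⟩
      by_cases hyv : y = v
      · subst hyv
        rw [htv, mul_one, SG.sign_symm]
        exact hv x hx' hxy.symm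
      · have hy' := Finset.mem_erase.2 ⟨hyv, hy⟩
        have h0 := hbal x hx' y hy' hxy
        have h1 := hT x hx' y hy'
        have h2 := hT y hy' x hx'
        rw [ht x hxv, ht y hyv]
        by_cases hTx : T x <;> by_cases hTy : T y
        · simpa [hTx, hTy] using h0
        · exact absurd hxy (h1 hTx hTy)
        · exact absurd hxy.symm (h2 hTy hTx)
        · simpa [hTx, hTy] using h0

/-- The bound on non-adjacent pairs when some vertex deletion yields a balanced subgraph. -/
lemma card_nonadj_of_balancedOn_erase (h3 : ¬ SG.HasNegCycleLength 3)
    (h4 : ¬ SG.HasNegCycleLength 4) {S : Finset V} {v : V} (hv : v ∈ S)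
    (hS : ¬ SG.BalancedOn S) (hSv : SG.BalancedOn (S.erase v)) :
    4 * S.card ≤ SG.Gᶜ.adjPairs S S + 10 := by
  obtain ⟨s, hs, hbal⟩ := hSv
  set U := S.erase v with hU
  have hUv : ∀ x ∈ U, x ≠ v := fun x hx => Finset.ne_of_mem_erase hx
  set P := fun x => SG.G.Adj v x ∧ s x * SG.sign v x = 1 with hP
  set N := fun x => SG.G.Adj v x ∧ s x * SG.sign v x = -1 with hN
  have hPN : ∀ x, SG.G.Adj v x → (P x ∧ ¬ N x) ∨ (N x ∧ ¬ P x) := by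
    intro x hx
    rcases SG.sign_pm _ _ hx with h | h <;> rcases hs x with h' | h' <;> simp [hP, hN, hx, h, h']
  have hPNadj : ∀ x ∈ U, ∀ y ∈ U, P x → N y → ¬ SG.G.Adj x y := by
    intro x hx y hy ⟨hvx, h1⟩ ⟨hvy, h2⟩ hxy
    have e1 := SG.sign_triangle h3 hvx hxy hvy.symm
    have e2 := hbal x hx y hy hxy
    rw [SG.sign_symm y v] at e1
    rcases SG.sign_pm _ _ hvx with h | h <;> rcases SG.sign_pm _ _ hvy with h' | h' <;>
      rcases SG.sign_pm _ _ hxy with h'' | h'' <;> simp_all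
  have hPNcommon : ∀ x ∈ U, ∀ y ∈ U, ∀ z ∈ U, P x → N y → SG.G.Adj x z → ¬ SG.G.Adj z y := by
    intro x hx y hy z hz ⟨hvx, h1⟩ ⟨hvy, h2⟩ hxz hzy
    have hne : x ≠ y := by
      rintro rfl
      omega
    have e1 := SG.sign_quadrilateral h4 hvx hxz hzy hvy.symm (hUv z hz).symm hne
    have e2 := hbal x hx z hz hxz
    have e3 := hbal z hz y hy hzy
    rw [SG.sign_symm y v] at e1
    rcases SG.sign_pm _ _ hvx with h | h <;> rcases SG.sign_pm _ _ hvy with h' | h' <;>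
      rcases SG.sign_pm _ _ hxz with h'' | h'' <;> rcases SG.sign_pm _ _ hzy with h''' | h''' <;>
      simp_all
  set Q := fun z => ∃ x ∈ U, P x ∧ SG.G.Adj x z
  let A := U.filter P
  let B := U.filter N
  let C := U.filter fun z => ¬ SG.G.Adj v z ∧ Q z
  let D := U.filter fun z => ¬ SG.G.Adj v z ∧ ¬ Q z
  have mA : ∀ x, x ∈ A ↔ x ∈ U ∧ P x := fun x => Finset.mem_filter
  have mB : ∀ x, x ∈ B ↔ x ∈ U ∧ N x := fun x => Finset.mem_filter
  have mC : ∀ x, x ∈ C ↔ x ∈ U ∧ ¬ SG.G.Adj v x ∧ Q x := fun x => Finset.mem_filter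
  have mD : ∀ x, x ∈ D ↔ x ∈ U ∧ ¬ SG.G.Adj v x ∧ ¬ Q x := fun x => Finset.mem_filter
  have dAB : Disjoint A B := Finset.disjoint_left.2 fun x hx hx' => by grind
  have dCD : Disjoint C D := Finset.disjoint_left.2 fun x hx hx' => by grind
  have dABCD : Disjoint (A ∪ B) (C ∪ D) := Finset.disjoint_left.2 fun x hx hx' => by grind
  have hUeq : U = (A ∪ B) ∪ (C ∪ D) := by
    ext x
    have hxN : N x → SG.G.Adj v x := And.left
    have hxP : P x → SG.G.Adj v x := And.left
    have hx := hPN x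
    simp only [Finset.mem_union, mA, mB, mC, mD]
    generalize P x = p at hxP hx
    generalize N x = q at hxN hx
    generalize Q x = r
    grind
  obtain ⟨⟨b, hb⟩, ⟨d, hd⟩⟩ : B.Nonempty ∧ D.Nonempty := by
    by_contra hcon
    refine hS (SG.balancedOn_of_separation hs hbal N ?_ ?_)
    · intro x hx y hy hNx hNy hxy
      refine hcon ⟨⟨x, (mB x).2 ⟨hx, hNx⟩⟩, ⟨y, (mD y).2 ⟨hy, ?_, ?_⟩⟩⟩
      · intro hvy
        rcases hPN y hvy with h | h
        · exact hPNadj y hy x hx h.1 hNx hxy.symm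
        · exact hNy h.1
      · rintro ⟨z, hz, hPz, hzy⟩
        exact hPNcommon z hz x hx y hy hPz hNx hzy hxy.symm
    · intro x _ hvx
      simp [hN, hvx]
  obtain ⟨⟨a, ha⟩, ⟨c, hc⟩⟩ : A.Nonempty ∧ C.Nonempty := by
    by_contra hcon
    refine hS (SG.balancedOn_of_separation hs hbal (fun x => ¬ P x) ?_ ?_)
    · intro y hy x hx hPy hPx hyx
      rw [not_not] at hPx
      refine hcon ⟨⟨x, (mA x).2 ⟨hx, hPx⟩⟩, ⟨y, (mC y).2 ⟨hy, ?_, x, hx, hPx, hyx.symm⟩⟩⟩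
      intro hvy
      rcases hPN y hvy with h | h
      · exact hPy h.1
      · exact hPNadj x hx y hy hPx h.1 hyx.symm
    · intro x _ hvx
      have e : s x * SG.sign v x = -1 ↔ N x := by simp [hN, hvx]
      rw [e]
      rcases hPN x hvx with h | h
      · exact iff_of_false (not_not.2 h.1) h.2
      · exact iff_of_true h.2 h.1
  refine SG.Gᶜ.card_le_adjPairs_of_partition hv hUeq dAB dCD dABCD ⟨a, ha⟩ ⟨b, hb⟩ ⟨c, hc⟩ ⟨d, hd⟩
    ?_ ?_ ?_ ?_
  · intro x hx y hy
    rw [mA] at hx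
    rw [mB] at hy
    refine (SG.G.compl_adj _ _).2 ⟨?_, hPNadj x hx.1 y hy.1 hx.2 hy.2⟩
    rintro rfl
    rcases hPN x hx.2.1 with h | h
    · exact h.2 hy.2
    · exact h.2 hx.2
  · intro x hx y hy
    rw [mA] at hx
    rw [mD] at hy
    refine (SG.G.compl_adj _ _).2 ⟨?_, fun h => hy.2.2 ⟨x, hx.1, hx.2, h⟩⟩
    rintro rfl
    exact hy.2.1 hx.2.1
  · intro x hx y hy
    rw [mB] at hx
    rw [mC] at hy
    obtain ⟨hyU, hvy, z, hz, hPz, hzy⟩ := hy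
    refine (SG.G.compl_adj _ _).2 ⟨?_, fun h =>
      hPNcommon z hz x hx.1 y hyU hPz hx.2 hzy h.symm⟩
    rintro rfl
    exact hvy hx.2.1
  · intro x hx
    rw [Finset.mem_union, mC, mD] at hx
    have hx' : x ∈ U ∧ ¬ SG.G.Adj v x := hx.elim (fun h => ⟨h.1, h.2.1⟩) fun h => ⟨h.1, h.2.1⟩
    exact (SG.G.compl_adj _ _).2 ⟨(hUv x hx'.1).symm, hx'.2⟩

/-- An induced unbalanced subgraph on `S` without negative triangles and quadrilaterals has at
least `2 |S| - 5` non-adjacent pairs of vertices. -/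
lemma card_nonadj_of_not_balancedOn (h3 : ¬ SG.HasNegCycleLength 3)
    (h4 : ¬ SG.HasNegCycleLength 4) (S : Finset V) (hS : ¬ SG.BalancedOn S) :
    4 * S.card ≤ SG.Gᶜ.adjPairs S S + 10 := by
  induction S using Finset.strongInduction with
  | H S ih =>
    obtain ⟨v, hv⟩ : S.Nonempty := by
      rw [Finset.nonempty_iff_ne_empty]
      rintro rfl
      exact hS ⟨1, by simp, by simp⟩
    by_cases hSv : SG.BalancedOn (S.erase v)
    · exact SG.card_nonadj_of_balancedOn_erase h3 h4 hv hS hSv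
    · have hrec := ih _ (Finset.erase_ssubset hv) hSv
      have hdeg : 2 ≤ ((S.erase v).filter (SG.Gᶜ.Adj v)).card := by
        by_contra! hlt
        obtain ⟨w, hw⟩ : ∃ w, (S.erase v).filter (SG.Gᶜ.Adj v) ⊆ {w} := by
          have : Nonempty V := ⟨v⟩
          exact Finset.card_le_one_iff_subset_singleton.1 (by omega)
        refine hS (SG.balancedOn_of_forall_adj h3 h4 (v := v) (w := w) fun x hx hxv hxw => ?_)
        by_contra hvx
        exact hxw (Finset.mem_singleton.1 (hw (by simp [hx, hxv, hvx, Ne.symm hxv])))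
      have := SG.Gᶜ.adjPairs_self_eq_erase hv
      have := Finset.card_erase_add_one hv
      omega

end SignedGraph

/-- An unbalanced signed graph of order `n` with at least `n(n-1)/2 - 2(n-3)` edges
contains a negative cycle of length at most `4`. -/
theorem unbalanced_many_edges_short_neg_cycle {V : Type*} [Fintype V] (n : ℕ)
    (SG : SignedGraph V) (hn : Fintype.card V = n) (hunb : SG.Unbalanced)
    (he : (n : ℝ) * ((n : ℝ) - 1) / 2 - 2 * ((n : ℝ) - 3) ≤ (SG.edgeCount : ℝ)) :
    SG.HasNegCycleLength 3 ∨ SG.HasNegCycleLength 4 := by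
  by_contra! hcon
  have hS : ¬ SG.BalancedOn Finset.univ := fun ⟨s, hs, h⟩ =>
    hunb ⟨s, hs, fun u v => h u (Finset.mem_univ u) v (Finset.mem_univ v)⟩
  have h1 := SG.card_nonadj_of_not_balancedOn hcon.1 hcon.2 _ hS
  have h2 := SG.G.adjPairs_compl_univ
  rw [Finset.card_univ, hn] at h1
  rw [hn] at h2
  have h1' : (4 * n : ℝ) ≤ (SG.Gᶜ.adjPairs Finset.univ Finset.univ : ℕ) + 10 := by
    exact_mod_cast h1
  have h2' : ((SG.Gᶜ.adjPairs Finset.univ Finset.univ : ℕ) : ℝ) + 2 * (SG.edgeCount : ℝ) + n =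
      n * n := by
    exact_mod_cast h2
  nlinarith
end

section
/- Let G be a connected finite simple graph on n vertices with e(G) edges. Then the largest eigenvalue of the adjacency matrix of G satisfies λ₁(G) ≤ √(2·e(G) − n + 1). -/
open scoped Classical

/-- The largest eigenvalue `λ₁(G)` of the adjacency matrix (over `ℝ`) of a simple
graph `G`. -/
noncomputable def graphLambdaMax {V : Type*} [Fintype V] (G : SimpleGraph V) : ℝ :=
  sSup {μ : ℝ | ∃ x : V → ℝ, x ≠ 0 ∧ (SimpleGraph.adjMatrix ℝ G).mulVec x = μ • x}

open Finset in
/-- In a connected graph, the degrees of the neighbours of a vertex sum to at most `2m - n + 1`. -/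
theorem SimpleGraph.Connected.sum_degree_neighborFinset_le {V : Type*} [Fintype V]
    {G : SimpleGraph V} [DecidableRel G.Adj] (hconn : G.Connected) (j : V) :
    ∑ i ∈ G.neighborFinset j, (G.degree i : ℝ) ≤
      2 * (G.edgeSet.ncard : ℝ) - (Fintype.card V : ℝ) + 1 := by
  have hedges : ∑ i, (G.degree i : ℝ) = 2 * (G.edgeSet.ncard : ℝ) := by
    rw [← SimpleGraph.coe_edgeFinset, Set.ncard_coe_finset]
    exact_mod_cast G.sum_degrees_eq_twice_card_edges
  have hpoint : ∀ i, (if i = j then (G.degree j : ℝ) - 1 else 0) ≤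
      G.degree i - (if G.Adj j i then (G.degree i : ℝ) else 0) - 1
        + (if G.Adj j i then 1 else 0) := by
    intro i
    by_cases hij : i = j
    · subst hij
      simp
    · have : Nontrivial V := ⟨i, j, hij⟩
      have hdeg : (1 : ℝ) ≤ G.degree i := by
        exact_mod_cast hconn.preconnected.degree_pos_of_nontrivial i
      by_cases hadj : G.Adj j i <;> simp [hij, hadj, hdeg]
  have hsum := sum_le_sum fun i (_ : i ∈ univ) => hpoint i
  have hdegree : ∑ i, (if G.Adj j i then (1 : ℝ) else 0) = G.degree j := by
    rw [sum_boole, ← G.neighborFinset_eq_filter, G.card_neighborFinset_eq_degree]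
  rw [sum_add_distrib, sum_sub_distrib, sum_sub_distrib, hedges, hdegree] at hsum
  simp only [sum_ite_eq', mem_univ, if_true, sum_const, card_univ, nsmul_eq_mul, mul_one] at hsum
  rw [G.neighborFinset_eq_filter, sum_filter]
  linarith

open Finset in
/-- The square of an eigenvalue of the adjacency matrix is at most any common upper bound of the
sums of the degrees of the neighbours of a vertex. -/
theorem SimpleGraph.sq_eigenvalue_le_of_sum_degree_le {V : Type*} [Fintype V]
    {G : SimpleGraph V} [DecidableRel G.Adj] {c : ℝ} (hc : ∀ j, ∑ i ∈ G.neighborFinset j, (G.degree i : ℝ) ≤ c)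
    {μ : ℝ} {x : V → ℝ} (hx : x ≠ 0) (heig : (G.adjMatrix ℝ).mulVec x = μ • x) :
    μ ^ 2 ≤ c := by
  have hpos : 0 < ∑ j, x j ^ 2 := by
    obtain ⟨j, hj⟩ := Function.ne_iff.mp hx
    exact sum_pos' (fun _ _ => sq_nonneg _) ⟨j, mem_univ j, sq_pos_of_ne_zero hj⟩
  refine le_of_mul_le_mul_right ?_ hpos
  calc μ ^ 2 * ∑ i, x i ^ 2
      = ∑ i, (∑ j ∈ G.neighborFinset i, x j) ^ 2 := by
        rw [mul_sum]
        refine sum_congr rfl fun i _ => ?_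
        rw [← SimpleGraph.adjMatrix_mulVec_apply, heig, Pi.smul_apply, smul_eq_mul, mul_pow]
    _ ≤ ∑ i, ∑ j ∈ G.neighborFinset i, G.degree i * x j ^ 2 := by
        refine sum_le_sum fun i _ => ?_
        rw [← mul_sum, ← G.card_neighborFinset_eq_degree]
        exact sq_sum_le_card_mul_sum_sq
    _ = ∑ j, (∑ i ∈ G.neighborFinset j, (G.degree i : ℝ)) * x j ^ 2 := by
        simp_rw [sum_mul]
        exact sum_comm' (by simp [SimpleGraph.adj_comm])
    _ ≤ c * ∑ j, x j ^ 2 := by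
        rw [mul_sum]
        exact sum_le_sum fun j _ => mul_le_mul_of_nonneg_right (hc j) (sq_nonneg _)

/-- Hong's bound: for a connected graph `G` on `n` vertices,
`λ₁(G) ≤ √(2·e(G) - n + 1)`. -/
theorem hong_spectral_bound {V : Type*} [Fintype V] (G : SimpleGraph V) (n : ℕ)
    (hn : Fintype.card V = n) (hconn : G.Connected) :
    graphLambdaMax G ≤ Real.sqrt (2 * (G.edgeSet.ncard : ℝ) - (n : ℝ) + 1) := by
  subst hn
  refine Real.sSup_le ?_ (Real.sqrt_nonneg _)
  rintro μ ⟨x, hx, heig⟩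
  exact Real.le_sqrt_of_sq_le
    (SimpleGraph.sq_eigenvalue_le_of_sum_degree_le hconn.sum_degree_neighborFinset_le hx heig)
end

section
/- Let Ġ be a connected signed graph on n vertices with frustration index l. Then the largest eigenvalue of the adjacency matrix of Ġ satisfies λ₁(Ġ) ≤ √(2(e(Ġ) − l) − n + 1). -/
open scoped Classical

namespace SignedGraph

variable {V : Type*}

/-- The adjacency matrix of a signed graph. -/
noncomputable def adjMatrix [Fintype V] (SG : SignedGraph V) : Matrix V V ℝ :=
  Matrix.of fun u v => if SG.G.Adj u v then (SG.sign u v : ℝ) else 0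

/-- The largest eigenvalue `λ₁` of the adjacency matrix of a signed graph. -/
noncomputable def lambdaMax [Fintype V] (SG : SignedGraph V) : ℝ :=
  sSup {μ : ℝ | ∃ x : V → ℝ, x ≠ 0 ∧ SG.adjMatrix.mulVec x = μ • x}

/-- The smallest eigenvalue `λₙ` of the adjacency matrix of a signed graph. -/
noncomputable def lambdaMin [Fintype V] (SG : SignedGraph V) : ℝ :=
  sInf {μ : ℝ | ∃ x : V → ℝ, x ≠ 0 ∧ SG.adjMatrix.mulVec x = μ • x}

/-- The spectral radius `ρ(Ġ) = max {λ₁(Ġ), -λₙ(Ġ)}` of a signed graph. -/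
noncomputable def specRadius [Fintype V] (SG : SignedGraph V) : ℝ :=
  max SG.lambdaMax (-SG.lambdaMin)

end SignedGraph

namespace SignedGraph

variable {V : Type*}

/-- The signed graph obtained by deleting a set of edges. -/
def deleteEdges (SG : SignedGraph V) (F : Set (Sym2 V)) : SignedGraph V where
  G := SG.G.deleteEdges F
  sign := SG.sign
  sign_symm := SG.sign_symm
  sign_pm := fun u v h => SG.sign_pm u v (SimpleGraph.deleteEdges_adj.mp h).1

/-- The frustration index of `Ġ`: the minimum number of edges of `Ġ` whose removal
results in a balanced signed graph. -/
noncomputable def frustrationIndex [Fintype V] (SG : SignedGraph V) : ℕ :=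
  sInf {m | ∃ F : Set (Sym2 V), F ⊆ SG.G.edgeSet ∧ F.ncard = m ∧
    (SG.deleteEdges F).Balanced}

end SignedGraph

/-- If every vertex of `P` has a neighbor, the degrees of the neighbors of a vertex sum to at
most `2 e(P) - n + 1`. -/
theorem SimpleGraph.sum_degree_neighborFinset_le {V : Type*} [Fintype V] (P : SimpleGraph V)
    (hdeg : ∀ i, 1 ≤ P.degree i) (j : V) :
    ∑ i ∈ P.neighborFinset j, P.degree i + Fintype.card V ≤ 2 * P.edgeFinset.card + 1 := by
  rw [← P.sum_degrees_eq_twice_card_edges,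
    ← Finset.sum_add_sum_compl (P.neighborFinset j) (fun i => P.degree i)]
  have hj : j ∈ (P.neighborFinset j)ᶜ := by simp
  rw [← Finset.add_sum_erase _ _ hj]
  have h1 : ((P.neighborFinset j)ᶜ.erase j).card ≤
      ∑ i ∈ (P.neighborFinset j)ᶜ.erase j, P.degree i := by
    rw [Finset.card_eq_sum_ones]
    exact Finset.sum_le_sum fun i _ => hdeg i
  rw [Finset.card_erase_of_mem hj, Finset.card_compl, P.card_neighborFinset_eq_degree] at h1
  omega

/-- A form of Hong's bound: it only needs a nonnegative vector `y` with `μ y ≤ A y`, where `A` is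
the adjacency matrix of a graph without isolated vertices. -/
theorem SimpleGraph.sq_le_of_smul_le_sum_neighborFinset {V : Type*} [Fintype V]
    (P : SimpleGraph V) (hdeg : ∀ i, 1 ≤ P.degree i) {μ : ℝ} (hμ : 0 ≤ μ) {y : V → ℝ}
    (hy : ∀ i, 0 ≤ y i) (hy0 : y ≠ 0) (h : ∀ i, μ * y i ≤ ∑ j ∈ P.neighborFinset i, y j) :
    μ ^ 2 ≤ 2 * (P.edgeFinset.card : ℝ) - Fintype.card V + 1 := by
  obtain ⟨k, hk⟩ := Function.ne_iff.mp hy0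
  have hpos : 0 < ∑ i, y i ^ 2 :=
    Finset.sum_pos' (fun i _ => sq_nonneg _) ⟨k, Finset.mem_univ k, by
      have : y k ≠ 0 := hk
      positivity⟩
  refine le_of_mul_le_mul_right ?_ hpos
  calc μ ^ 2 * ∑ i, y i ^ 2 = ∑ i, (μ * y i) ^ 2 := by simp only [mul_pow, Finset.mul_sum]
    _ ≤ ∑ i, (P.degree i : ℝ) * ∑ j ∈ P.neighborFinset i, y j ^ 2 := by
      refine Finset.sum_le_sum fun i _ => ?_
      calc (μ * y i) ^ 2 ≤ (∑ j ∈ P.neighborFinset i, y j) ^ 2 :=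
            pow_le_pow_left₀ (mul_nonneg hμ (hy i)) (h i) 2
        _ ≤ _ := by
          rw [← P.card_neighborFinset_eq_degree]
          exact sq_sum_le_card_mul_sum_sq
    _ = ∑ j, (∑ i ∈ P.neighborFinset j, (P.degree i : ℝ)) * y j ^ 2 := by
      simp only [Finset.mul_sum, Finset.sum_mul]
      exact Finset.sum_comm' fun i j => by simp [P.adj_comm]
    _ ≤ ∑ j, (2 * (P.edgeFinset.card : ℝ) - Fintype.card V + 1) * y j ^ 2 := by
      refine Finset.sum_le_sum fun j _ => mul_le_mul_of_nonneg_right ?_ (sq_nonneg _)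
      have := P.sum_degree_neighborFinset_le hdeg j
      have : (∑ i ∈ P.neighborFinset j, (P.degree i : ℝ)) + Fintype.card V ≤
          2 * P.edgeFinset.card + 1 := by exact_mod_cast this
      linarith
    _ = _ := by rw [Finset.mul_sum]

namespace SignedGraph

variable {V : Type*} (SG : SignedGraph V)

/-- The subgraph of edges that become positive after switching by `s`. -/
def positiveGraph (s : V → ℤ) : SimpleGraph V where
  Adj u v := SG.G.Adj u v ∧ s u * SG.sign u v * s v = 1
  symm := ⟨fun u v h => ⟨h.1.symm, by rw [SG.sign_symm v u, ← h.2]; ring⟩⟩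
  loopless := ⟨fun u h => SG.G.loopless.irrefl u h.1⟩

theorem positiveGraph_le (s : V → ℤ) : SG.positiveGraph s ≤ SG.G := fun _ _ h => h.1

theorem switch_sign_pm {s : V → ℤ} (hs : ∀ i, s i = 1 ∨ s i = -1) {u v : V}
    (h : SG.G.Adj u v) : s u * SG.sign u v * s v = 1 ∨ s u * SG.sign u v * s v = -1 := by
  rcases hs u with h1 | h1 <;> rcases hs v with h2 | h2 <;>
    rcases SG.sign_pm u v h with h3 | h3 <;> simp [h1, h2, h3]

variable [Fintype V]

theorem frustrationIndex_add_card_positiveGraph_le {s : V → ℤ} (hs : ∀ i, s i = 1 ∨ s i = -1) :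
    SG.frustrationIndex + (SG.positiveGraph s).edgeFinset.card ≤ SG.edgeCount := by
  have hsub := SimpleGraph.edgeSet_mono (SG.positiveGraph_le s)
  have hle : SG.frustrationIndex ≤ (SG.G.edgeSet \ (SG.positiveGraph s).edgeSet).ncard := by
    refine Nat.sInf_le ⟨_, Set.sdiff_subset, rfl, s, hs, fun u v h => ?_⟩
    obtain ⟨h1, h2⟩ := SimpleGraph.deleteEdges_adj.mp h
    by_contra hne
    exact h2 ⟨h1, fun h3 => hne h3.2⟩
  have hcard := Set.ncard_sdiff_add_ncard_of_subset hsub (Set.toFinite _)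
  have : (SG.positiveGraph s).edgeSet.ncard = (SG.positiveGraph s).edgeFinset.card := by
    rw [Set.ncard_eq_toFinset_card', SimpleGraph.edgeFinset]
  unfold edgeCount
  omega

theorem adjMatrix_apply (u v : V) :
    SG.adjMatrix u v = if SG.G.Adj u v then (SG.sign u v : ℝ) else 0 := rfl

theorem adjMatrix_isSymm : SG.adjMatrix.IsSymm :=
  Matrix.IsSymm.ext fun u v => by
    simp only [adjMatrix_apply, SG.G.adj_comm u v, SG.sign_symm u v]

/-- Among the switchings making `x` nonnegative, one maximizing the number of positive edges leaves
each zero of `x` with nonnegative net degree. -/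
theorem exists_switch_nonneg (x : V → ℝ) :
    ∃ s : V → ℤ, (∀ i, s i = 1 ∨ s i = -1) ∧ (∀ i, 0 ≤ (s i : ℝ) * x i) ∧
      ∀ i, x i = 0 → 0 ≤ ∑ j, (s i : ℝ) * SG.adjMatrix i j * s j := by
  let S : Finset (V → ℤ) :=
    Fintype.piFinset fun i => ({1, -1} : Finset ℤ).filter fun t => 0 ≤ (t : ℝ) * x i
  have hmem (s : V → ℤ) : s ∈ S ↔ ∀ i, (s i = 1 ∨ s i = -1) ∧ 0 ≤ (s i : ℝ) * x i := by
    simp [S, Fintype.mem_piFinset]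
  have hne : S.Nonempty := by
    refine ⟨fun i => if 0 ≤ x i then 1 else -1, (hmem _).2 fun i => ?_⟩
    split_ifs with h
    · simpa using h
    · simpa using (not_le.mp h).le
  obtain ⟨s, hsS, hmax⟩ := S.exists_max_image
    (fun s => (fun i => (s i : ℝ)) ⬝ᵥ SG.adjMatrix.mulVec fun i => (s i : ℝ)) hne
  have hs := (hmem s).1 hsS
  refine ⟨s, fun i => (hs i).1, fun i => (hs i).2, fun v hv => ?_⟩
  have hflip := hmax (Function.update s v (-s v)) <| (hmem _).2 fun i => by
    rcases eq_or_ne i v with rfl | hi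
    · have := (hs i).1
      simp only [Function.update_self, hv, mul_zero, le_refl, and_true]
      omega
    · simpa [Function.update_of_ne hi] using hs i
  have hupd : (fun i => ((Function.update s v (-s v) i : ℤ) : ℝ)) =
      (fun i => (s i : ℝ)) + Pi.single v (-2 * (s v : ℝ)) := by
    ext i
    rcases eq_or_ne i v with rfl | hi
    · simp; ring
    · simp [hi]
  have hswap : (fun i => (s i : ℝ)) ⬝ᵥ SG.adjMatrix.mulVec (Pi.single v (-2 * (s v : ℝ))) =
      -2 * (s v : ℝ) * SG.adjMatrix.mulVec (fun i => (s i : ℝ)) v := by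
    rw [Matrix.dotProduct_mulVec, dotProduct_single, ← Matrix.mulVec_transpose,
      SG.adjMatrix_isSymm.eq, mul_comm]
  have hdiag : SG.adjMatrix v v = 0 := by simp [adjMatrix_apply]
  have hsum : ∑ j, (s v : ℝ) * SG.adjMatrix v j * s j =
      s v * SG.adjMatrix.mulVec (fun i => (s i : ℝ)) v := by
    simp only [Matrix.mulVec, dotProduct, Finset.mul_sum, mul_assoc]
  rw [hupd, Matrix.mulVec_add, add_dotProduct, dotProduct_add, dotProduct_add, hswap,
    single_dotProduct, single_dotProduct, Matrix.mulVec_single] at hflip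
  have hself : (MulOpposite.op (-2 * (s v : ℝ)) • SG.adjMatrix.col v) v = 0 := by simp [hdiag]
  rw [hself] at hflip
  rw [hsum]
  linarith

/-- Hong's bound for the subgraph of positive edges of a suitable switching. -/
theorem sq_eigenvalue_le [Nontrivial V] (hconn : SG.G.Connected) {μ : ℝ} (hμ : 0 < μ) {x : V → ℝ}
    (hx : x ≠ 0) (hA : SG.adjMatrix.mulVec x = μ • x) :
    μ ^ 2 ≤ 2 * ((SG.edgeCount : ℝ) - SG.frustrationIndex) - Fintype.card V + 1 := by
  obtain ⟨s, hs, hsx, hzero⟩ := SG.exists_switch_nonneg x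
  set P := SG.positiveGraph s
  have hss (i : V) : (s i : ℝ) * s i = 1 := by rcases hs i with h | h <;> simp [h]
  have hentry (i j : V) :
      (s i : ℝ) * SG.adjMatrix i j * s j ≤ if P.Adj i j then 1 else 0 := by
    rw [adjMatrix_apply]
    by_cases hG : SG.G.Adj i j
    · rcases SG.switch_sign_pm hs hG with h | h
      · rw [if_pos hG, if_pos ⟨hG, h⟩]
        exact_mod_cast h.le
      · rw [if_pos hG, if_neg fun hP => by have := hP.2; omega]
        have : (s i : ℝ) * SG.sign i j * s j = -1 := by exact_mod_cast h
        linarith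
    · rw [if_neg hG, if_neg fun hP => hG hP.1]
      simp
  have hsub (i : V) : μ * (s i * x i) ≤ ∑ j ∈ P.neighborFinset i, (s j : ℝ) * x j := by
    have h1 : μ * x i = ∑ j, SG.adjMatrix i j * x j := (congrFun hA i).symm
    calc μ * (s i * x i) = ∑ j, (s i * SG.adjMatrix i j * s j) * (s j * x j) := by
          rw [mul_left_comm, h1, Finset.mul_sum]
          refine Finset.sum_congr rfl fun j _ => ?_
          linear_combination (-(s i : ℝ) * SG.adjMatrix i j * x j) * hss j
      _ ≤ ∑ j, (if P.Adj i j then 1 else 0) * ((s j : ℝ) * x j) :=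
          Finset.sum_le_sum fun j _ => mul_le_mul_of_nonneg_right (hentry i j) (hsx j)
      _ = _ := by
          simp only [ite_mul, one_mul, zero_mul]
          rw [← Finset.sum_filter, P.neighborFinset_eq_filter]
  have hdeg (i : V) : 1 ≤ P.degree i := by
    by_contra hlt
    have hiso : P.neighborFinset i = ∅ := by
      rw [← Finset.card_eq_zero, P.card_neighborFinset_eq_degree]
      omega
    have hnadj (j : V) : ¬ P.Adj i j := fun h => by
      have := (P.mem_neighborFinset i j).2 h
      simp [hiso] at this
    have hxi : x i = 0 := by
      have h1 := hsub i
      rw [hiso, Finset.sum_empty] at h1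
      have h2 : (s i : ℝ) * x i = 0 := le_antisymm (nonpos_of_mul_nonpos_right h1 hμ) (hsx i)
      linear_combination (s i : ℝ) * h2 - x i * hss i
    obtain ⟨j, hj⟩ := hconn.preconnected.exists_adj_of_nontrivial i
    refine (hzero i hxi).not_gt (Finset.sum_neg' (fun k _ => ?_) ⟨j, Finset.mem_univ j, ?_⟩)
    · simpa [hnadj k] using hentry i k
    · have h := (SG.switch_sign_pm hs hj).resolve_left fun h => hnadj j ⟨hj, h⟩
      have : (s i : ℝ) * SG.sign i j * s j = -1 := by exact_mod_cast h
      rw [adjMatrix_apply, if_pos hj, this]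
      norm_num
  have hne : (fun i => (s i : ℝ) * x i) ≠ 0 := fun h => hx <| funext fun i => by
    have h2 : (s i : ℝ) * x i = 0 := congrFun h i
    show x i = 0
    linear_combination (s i : ℝ) * h2 - x i * hss i
  have hbound := P.sq_le_of_smul_le_sum_neighborFinset hdeg hμ.le hsx hne hsub
  have hfr : (SG.frustrationIndex : ℝ) + P.edgeFinset.card ≤ SG.edgeCount := by
    exact_mod_cast SG.frustrationIndex_add_card_positiveGraph_le hs
  linarith

end SignedGraph

/-- Stanić's bound: for a connected signed graph on `n` vertices with frustration
index `l`, `λ₁(Ġ) ≤ √(2(e(Ġ) - l) - n + 1)`. -/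
theorem stanic_spectral_bound {V : Type*} [Fintype V] (SG : SignedGraph V) (n : ℕ)
    (hn : Fintype.card V = n) (hconn : SG.G.Connected) :
    SG.lambdaMax ≤
      Real.sqrt (2 * ((SG.edgeCount : ℝ) - (SG.frustrationIndex : ℝ)) - (n : ℝ) + 1) := by
  subst hn
  refine Real.sSup_le ?_ (Real.sqrt_nonneg _)
  rintro μ ⟨x, hx, hA⟩
  rcases le_or_gt μ 0 with hμ | hμ
  · exact hμ.trans (Real.sqrt_nonneg _)
  refine Real.le_sqrt_of_sq_le ?_
  rcases subsingleton_or_nontrivial V with hV | hV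
  · refine absurd (funext fun i => ?_) hx
    have h : SG.adjMatrix.mulVec x i = μ * x i := congrFun hA i
    have h0 : SG.adjMatrix.mulVec x i = 0 := Finset.sum_eq_zero fun j _ => by
      rw [Subsingleton.elim j i]
      simp [SignedGraph.adjMatrix_apply]
    exact (mul_eq_zero.mp (h.symm.trans h0)).resolve_left hμ.ne'
  · exact SG.sq_eigenvalue_le hconn hμ hx hA
end
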